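/- arXiv:1701.07770 — 9 statements merged into one kernel-verified Lean document; each statement's English description precedes it below -/
import Mathlib

section
/- Let χ < 0, n ≥ 0 and k ≥ 1 be integers with 6χ + 3n ≤ 3, and define f : [0,∞) → ℝ by f(r) = (6 − (6χ+3n)/k)·α(r) + (2n/k)·β(r). Then f is continuous and strictly decreasing, f(0) = 2π − 2πχ/k > 2π, f(r) → 0 as r → ∞, and consequently there is a unique r > 0 with f(r) = 2π. -/
open Real Filter

/-- The vertex angle of a hyperbolic equilateral triangle with side length `2r`. -/
noncomputable def hypAlpha (r : ℝ) : ℝ := 2 * Real.arcsin (1 / (2 * Real.cosh r))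

/-- The angle at a finite vertex of a horocyclic ideal triangle with compact side
length `2r`. -/
noncomputable def hypBeta (r : ℝ) : ℝ := Real.arcsin (1 / Real.cosh r)

theorem stmt_0 (χ n k : ℤ) (hχ : χ < 0) (hn : 0 ≤ n) (hk : 1 ≤ k)
    (hcond : 6 * χ + 3 * n ≤ 3) (f : ℝ → ℝ)
    (hf : ∀ r : ℝ, f r =
      (6 - ((6 * χ + 3 * n : ℤ) : ℝ) / (k : ℝ)) * hypAlpha r
        + (((2 * n : ℤ) : ℝ) / (k : ℝ)) * hypBeta r) :
    ContinuousOn f (Set.Ici 0) ∧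
    StrictAntiOn f (Set.Ici 0) ∧
    f 0 = 2 * Real.pi - 2 * Real.pi * (χ : ℝ) / (k : ℝ) ∧
    2 * Real.pi < f 0 ∧
    Tendsto f atTop (nhds 0) ∧
    (∃! r : ℝ, 0 < r ∧ f r = 2 * Real.pi) := by
  have hk' : (1 : ℝ) ≤ (k : ℝ) := by exact_mod_cast hk
  have hk0 : (0 : ℝ) < (k : ℝ) := by linarith
  have hχ' : (χ : ℝ) < 0 := by exact_mod_cast hχ
  have hA : 0 < 6 - ((6 * χ + 3 * n : ℤ) : ℝ) / (k : ℝ) := by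
    have h3 : ((6 * χ + 3 * n : ℤ) : ℝ) ≤ 3 := by exact_mod_cast hcond
    have : ((6 * χ + 3 * n : ℤ) : ℝ) / (k : ℝ) ≤ 3 := by
      rw [div_le_iff₀ hk0]; linarith
    linarith
  have hB : 0 ≤ ((2 * n : ℤ) : ℝ) / (k : ℝ) := by
    have : (0 : ℝ) ≤ ((2 * n : ℤ) : ℝ) := by
      have h2 : (0 : ℤ) ≤ 2 * n := by omega
      exact_mod_cast h2
    positivity
  have hcα : Continuous hypAlpha := by
    unfold hypAlpha
    refine continuous_const.mul (Real.continuous_arcsin.comp ?_)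
    refine continuous_const.div (continuous_const.mul Real.continuous_cosh) ?_
    intro x
    have := Real.cosh_pos x
    positivity
  have hcβ : Continuous hypBeta := by
    unfold hypBeta
    refine Real.continuous_arcsin.comp ?_
    exact continuous_const.div Real.continuous_cosh (fun x => (Real.cosh_pos x).ne')
  have hfe : f = fun r => (6 - ((6 * χ + 3 * n : ℤ) : ℝ) / (k : ℝ)) * hypAlpha r
        + (((2 * n : ℤ) : ℝ) / (k : ℝ)) * hypBeta r := funext hf
  have hcont : Continuous f := by
    rw [hfe]
    exact (continuous_const.mul hcα).add (continuous_const.mul hcβ)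
  have hanti : StrictAntiOn f (Set.Ici 0) := by
    intro x hx y hy hxy
    have hc := Real.cosh_strictMonoOn hx hy hxy
    have h1 := Real.one_le_cosh x
    have h2 := Real.one_le_cosh y
    have hα : hypAlpha y < hypAlpha x := by
      unfold hypAlpha
      have : Real.arcsin (1 / (2 * Real.cosh y)) < Real.arcsin (1 / (2 * Real.cosh x)) := by
        apply Real.strictMonoOn_arcsin
        · constructor
          · have : 0 < 1 / (2 * Real.cosh y) := by positivity
            linarith
          · rw [div_le_one (by positivity)]; linarith
        · constructor
          · have : 0 < 1 / (2 * Real.cosh x) := by positivity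
            linarith
          · rw [div_le_one (by positivity)]; linarith
        · exact one_div_lt_one_div_of_lt (by positivity) (by linarith)
      linarith
    have hβ : hypBeta y ≤ hypBeta x := by
      unfold hypBeta
      apply Real.monotone_arcsin
      exact one_div_le_one_div_of_le (by positivity) hc.le
    rw [hf x, hf y]
    have e1 := mul_lt_mul_of_pos_left hα hA
    have e2 := mul_le_mul_of_nonneg_left hβ hB
    linarith
  have hα0 : hypAlpha 0 = Real.pi / 3 := by
    unfold hypAlpha
    have : Real.arcsin (1 / (2 * Real.cosh 0)) = Real.pi / 6 := by
      apply Real.arcsin_eq_of_sin_eq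
      · rw [Real.sin_pi_div_six, Real.cosh_zero]; norm_num
      · constructor <;> linarith [Real.pi_pos]
    rw [this]; ring
  have hβ0 : hypBeta 0 = Real.pi / 2 := by
    unfold hypBeta
    rw [Real.cosh_zero, div_one, Real.arcsin_one]
  have hf0 : f 0 = 2 * Real.pi - 2 * Real.pi * (χ : ℝ) / (k : ℝ) := by
    rw [hf, hα0, hβ0]
    push_cast
    field_simp
    ring
  have hgt : 2 * Real.pi < f 0 := by
    rw [hf0]
    have : 2 * Real.pi * (χ : ℝ) / (k : ℝ) < 0 :=
      div_neg_of_neg_of_pos (mul_neg_of_pos_of_neg (by positivity) hχ') hk0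
    linarith
  have hcosh : Tendsto Real.cosh atTop atTop := by
    have h : Tendsto (fun x : ℝ => Real.exp x / 2) atTop atTop :=
      Real.tendsto_exp_atTop.atTop_div_const (by norm_num)
    refine tendsto_atTop_mono (fun x => ?_) h
    rw [Real.cosh_eq]
    linarith [Real.exp_pos (-x)]
  have htend : Tendsto f atTop (nhds 0) := by
    have hlβ : Tendsto hypBeta atTop (nhds 0) := by
      have h := (Real.continuous_arcsin.tendsto 0).comp (hcosh.const_div_atTop 1)
      rw [Real.arcsin_zero] at h
      exact h
    have hlα : Tendsto hypAlpha atTop (nhds 0) := by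
      have h := ((Real.continuous_arcsin.tendsto 0).comp
        ((hcosh.const_mul_atTop (show (0 : ℝ) < 2 by norm_num)).const_div_atTop 1)).const_mul 2
      rw [Real.arcsin_zero, mul_zero] at h
      exact h
    rw [hfe]
    have h := (hlα.const_mul (6 - ((6 * χ + 3 * n : ℤ) : ℝ) / (k : ℝ))).add
      (hlβ.const_mul (((2 * n : ℤ) : ℝ) / (k : ℝ)))
    rw [mul_zero, mul_zero, add_zero] at h
    exact h
  refine ⟨hcont.continuousOn, hanti, hf0, hgt, htend, ?_⟩
  obtain ⟨b, hb, hb0⟩ := ((htend.eventually_lt_const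
    (show (0 : ℝ) < 2 * Real.pi by positivity)).and (eventually_ge_atTop 0)).exists
  obtain ⟨r, hr, hfr⟩ := intermediate_value_Icc' hb0 hcont.continuousOn ⟨hb.le, hgt.le⟩
  refine ⟨r, ⟨lt_of_le_of_ne hr.1 ?_, hfr⟩, ?_⟩
  · rintro rfl
    linarith
  · rintro s ⟨hs, hfs⟩
    exact hanti.injOn (Set.mem_Ici.2 hs.le) (Set.mem_Ici.2 hr.1) (hfs.trans hfr.symm)
end

section
/- For every real r > 0 one has 2·β(r) < 3·α(r), i.e. 2·arcsin(1/cosh r) < 6·arcsin(1/(2·cosh r)). -/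
open Real

theorem stmt_2 (r : ℝ) (hr : 0 < r) : 2 * hypBeta r < 3 * hypAlpha r := by
  unfold hypBeta hypAlpha
  have hc : 1 < Real.cosh r := Real.one_lt_cosh.mpr hr.ne'
  have hy0 : 0 < 1 / (2 * Real.cosh r) := by positivity
  have hy1 : 1 / (2 * Real.cosh r) < 1 / 2 := by
    apply one_div_lt_one_div_of_lt <;> linarith
  have hx : 1 / Real.cosh r = 2 * (1 / (2 * Real.cosh r)) := by
    field_simp
  rw [hx]
  generalize 1 / (2 * Real.cosh r) = y at *
  have ht0 : 0 < Real.arcsin y := Real.arcsin_pos.mpr hy0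
  have hpi := Real.pi_pos
  have ht1 : Real.arcsin y < Real.pi / 6 := by
    rw [Real.arcsin_lt_iff_lt_sin' ⟨by linarith, by linarith⟩, Real.sin_pi_div_six]
    exact hy1
  have key : Real.arcsin (2 * y) < 3 * Real.arcsin y := by
    rw [Real.arcsin_lt_iff_lt_sin' ⟨by linarith, by linarith⟩, Real.sin_three_mul,
      Real.sin_arcsin (by linarith) (by linarith)]
    nlinarith [mul_pos hy0 (mul_pos (sub_pos.mpr hy1) (by linarith : 0 < 1 / 2 + y))]
  linarith
end

section
/- Let χ < 0 and k ≥ 1 be integers, and let r > 0 satisfy (6 − 6χ/k)·α(r) = 2π. Then cosh r < 1 − χ/k. (That is, the bound r_{χ,0}^k coming from Böröczky's theorem is strictly smaller than the naive area bound r_A^k defined by cosh(r_A^k) = 1 − χ/k.) -/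
open Real

theorem stmt_5 (χ k : ℤ) (hχ : χ < 0) (hk : 1 ≤ k) (r : ℝ) (hr : 0 < r)
    (heq : (6 - ((6 * χ : ℤ) : ℝ) / (k : ℝ)) * hypAlpha r = 2 * Real.pi) :
    Real.cosh r < 1 - (χ : ℝ) / (k : ℝ) := by
  have hk' : (0 : ℝ) < k := by exact_mod_cast (by omega : 0 < k)
  have hχ' : (χ : ℝ) < 0 := by exact_mod_cast hχ
  have hq : (χ : ℝ) / k < 0 := div_neg_of_neg_of_pos hχ' hk'
  have hc : 1 ≤ Real.cosh r := Real.one_le_cosh r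
  unfold hypAlpha at heq
  push_cast at heq
  rw [mul_div_assoc] at heq
  generalize (χ : ℝ) / k = q at *
  generalize Real.cosh r = c at *
  obtain ⟨x, rfl⟩ : ∃ x, q = 1 - x := ⟨1 - q, by ring⟩
  have hx : 1 < x := by linarith
  have hx0 : 0 < x := by linarith
  have ha : Real.arcsin (1 / (2 * c)) = (1 / x) * (Real.pi / 6) := by
    field_simp
    linarith
  have hle : 1 / (2 * c) ≤ 1 := by
    rw [div_le_one (by linarith)]; linarith
  have hge : -1 ≤ 1 / (2 * c) := by
    have : 0 ≤ 1 / (2 * c) := by positivity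
    linarith
  have hs : 1 / (2 * c) = Real.sin ((1 / x) * (Real.pi / 6)) := by
    rw [← ha, Real.sin_arcsin hge hle]
  have hpi := Real.pi_pos
  have h1 : 1 / x < 1 := by rw [div_lt_one hx0]; exact hx
  have h0 : 0 < 1 / x := by positivity
  have m0 : (0 : ℝ) ∈ Set.Icc 0 Real.pi := ⟨le_refl _, hpi.le⟩
  have m1 : Real.pi / 6 ∈ Set.Icc 0 Real.pi := ⟨by linarith, by linarith⟩
  have hne : (0 : ℝ) ≠ Real.pi / 6 := by positivity
  have hp : 0 < 1 - 1 / x := by linarith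
  have hsum : (1 - 1 / x) + 1 / x = 1 := by ring
  have hcv := strictConcaveOn_sin_Icc.right m0 m1 hne hp h0 hsum
  simp only [smul_eq_mul, Real.sin_zero, mul_zero, zero_add, Real.sin_pi_div_six] at hcv
  rw [← hs] at hcv
  have h2 : 1 / (2 * x) < 1 / (2 * c) := by
    calc 1 / (2 * x) = 1 / x * (1 / 2) := by field_simp
      _ < _ := hcv
  have h3 := (one_div_lt_one_div (by linarith) (by linarith)).1 h2
  linarith
end

section
/- Let χ < 0 and n ≥ 0 be integers with 6χ + 3n ≤ 3, and for each integer k ≥ 1 let r_k be the unique positive real with (6 − (6χ+3n)/k)·α(r_k) + (2n/k)·β(r_k) = 2π. Then the sequence (r_k) is strictly decreasing: r_{k+1} < r_k for all k ≥ 1. -/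
open Real

theorem stmt_7 (χ n : ℤ) (hχ : χ < 0) (hn : 0 ≤ n)
    (hcond : 6 * χ + 3 * n ≤ 3) (r : ℤ → ℝ)
    (hr : ∀ k : ℤ, 1 ≤ k → 0 < r k ∧
      (6 - ((6 * χ + 3 * n : ℤ) : ℝ) / (k : ℝ)) * hypAlpha (r k)
        + (((2 * n : ℤ) : ℝ) / (k : ℝ)) * hypBeta (r k) = 2 * Real.pi) :
    ∀ k : ℤ, 1 ≤ k → r (k + 1) < r k := by
  intro k hk
  obtain ⟨h0, h1⟩ := hr k hk
  obtain ⟨h0', h2⟩ := hr (k + 1) (by omega)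
  by_contra! hle
  have hc : Real.cosh (r k) ≤ Real.cosh (r (k + 1)) := by
    rw [Real.cosh_le_cosh, abs_of_pos h0, abs_of_pos h0']; exact hle
  have hp : 0 < Real.cosh (r k) := Real.cosh_pos _
  have hA : hypAlpha (r (k + 1)) ≤ hypAlpha (r k) := by
    unfold hypAlpha
    have := Real.monotone_arcsin (one_div_le_one_div_of_le (by positivity)
      (mul_le_mul_of_nonneg_left hc (by norm_num : (0 : ℝ) ≤ 2)))
    linarith
  have hB : hypBeta (r (k + 1)) ≤ hypBeta (r k) :=
    Real.monotone_arcsin (one_div_le_one_div_of_le hp hc)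
  have hlt : hypAlpha (r k) < Real.pi / 3 := by
    unfold hypAlpha
    have h1c : 1 < Real.cosh (r k) := Real.one_lt_cosh.2 h0.ne'
    have : Real.arcsin (1 / (2 * Real.cosh (r k))) < Real.pi / 6 := by
      rw [Real.arcsin_lt_iff_lt_sin' ⟨by linarith [Real.pi_pos], by linarith [Real.pi_pos]⟩,
        Real.sin_pi_div_six]
      exact one_div_lt_one_div_of_lt (by norm_num) (by linarith)
    linarith
  have hk' : (1 : ℝ) ≤ k := by exact_mod_cast hk
  have hm : ((6 * χ + 3 * n : ℤ) : ℝ) ≤ 3 := by exact_mod_cast hcond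
  have hn' : (0 : ℝ) ≤ ((2 * n : ℤ) : ℝ) := by exact_mod_cast (by omega : 0 ≤ 2 * n)
  rw [show ((k + 1 : ℤ) : ℝ) = (k : ℝ) + 1 by push_cast; rfl] at h2
  generalize ((6 * χ + 3 * n : ℤ) : ℝ) = m at *
  generalize ((2 * n : ℤ) : ℝ) = N at *
  generalize (k : ℝ) = K at *
  generalize hypAlpha (r k) = a at *
  generalize hypAlpha (r (k + 1)) = a' at *
  generalize hypBeta (r k) = b at *
  generalize hypBeta (r (k + 1)) = b' at *
  have hK : 0 < K := by linarith
  have e1 : (6 * K - m) * a + N * b = 2 * Real.pi * K := by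
    field_simp at h1; linarith
  have e2 : (6 * (K + 1) - m) * a' + N * b' = 2 * Real.pi * (K + 1) := by
    field_simp at h2; linarith
  have i1 : (6 * (K + 1) - m) * a' ≤ (6 * (K + 1) - m) * a :=
    mul_le_mul_of_nonneg_left hA (by linarith)
  have i2 : N * b' ≤ N * b := mul_le_mul_of_nonneg_left hB hn'
  linarith
end

section
/- Let χ < 0 and n ≥ 0 be integers with 6χ + 3n ≤ 3, and for each integer k ≥ 1 let r_k be the unique positive real with (6 − (6χ+3n)/k)·α(r_k) + (2n/k)·β(r_k) = 2π. Then r_k → 0 as k → ∞. -/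
open Real Filter

theorem stmt_8 (χ n : ℤ) (hχ : χ < 0) (hn : 0 ≤ n)
    (hcond : 6 * χ + 3 * n ≤ 3) (r : ℕ → ℝ)
    (hr : ∀ k : ℕ, 1 ≤ k → 0 < r k ∧
      (6 - ((6 * χ + 3 * n : ℤ) : ℝ) / (k : ℝ)) * hypAlpha (r k)
        + (((2 * n : ℤ) : ℝ) / (k : ℝ)) * hypBeta (r k) = 2 * Real.pi) :
    Tendsto r atTop (nhds 0) := by
  have hA : ∀ x : ℝ, |hypAlpha x| ≤ Real.pi := by
    intro x
    unfold hypAlpha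
    rw [abs_le]
    constructor
    · linarith [Real.neg_pi_div_two_le_arcsin (1 / (2 * Real.cosh x))]
    · linarith [Real.arcsin_le_pi_div_two (1 / (2 * Real.cosh x))]
  have hB : ∀ x : ℝ, |hypBeta x| ≤ Real.pi := by
    intro x
    unfold hypBeta
    rw [abs_le]
    constructor
    · linarith [Real.neg_pi_div_two_le_arcsin (1 / (Real.cosh x)), Real.pi_pos]
    · linarith [Real.arcsin_le_pi_div_two (1 / (Real.cosh x)), Real.pi_pos]
  have h0 : ∀ c : ℝ, Tendsto (fun k : ℕ => c / (k : ℝ)) atTop (nhds 0) := fun c =>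
    tendsto_const_div_atTop_nhds_zero_nat c
  have h1 : ∀ (c : ℝ) (f : ℝ → ℝ), (∀ x, |f x| ≤ Real.pi) →
      Tendsto (fun k : ℕ => c / (k : ℝ) * f (r k)) atTop (nhds 0) := by
    intro c f hf
    have h2 : Tendsto (fun k : ℕ => |c / (k : ℝ)| * Real.pi) atTop (nhds 0) := by
      simpa using (h0 c).abs.mul_const Real.pi
    refine squeeze_zero_norm (fun k => ?_) h2
    rw [Real.norm_eq_abs, abs_mul]
    exact mul_le_mul_of_nonneg_left (hf _) (abs_nonneg _)
  have hlim : Tendsto (fun k : ℕ => hypAlpha (r k)) atTop (nhds (Real.pi / 3)) := by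
    have h3 := (((h1 ((6 * χ + 3 * n : ℤ) : ℝ) hypAlpha hA).sub
      (h1 ((2 * n : ℤ) : ℝ) hypBeta hB)).const_add (2 * Real.pi)).div_const 6
    have e : (2 * Real.pi + (0 - 0)) / 6 = Real.pi / 3 := by ring
    rw [e] at h3
    refine h3.congr' ?_
    filter_upwards [eventually_ge_atTop 1] with k hk
    have := (hr k hk).2
    linarith
  have hlt : ∀ ε : ℝ, 0 < ε → hypAlpha ε < Real.pi / 3 := by
    intro ε hε
    have hc : 1 < Real.cosh ε := Real.one_lt_cosh.2 hε.ne'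
    have h4 : 1 / (2 * Real.cosh ε) < 1 / 2 := by
      apply one_div_lt_one_div_of_lt <;> linarith
    have h5 : Real.arcsin (1 / (2 * Real.cosh ε)) < Real.pi / 6 := by
      rw [Real.arcsin_lt_iff_lt_sin' ⟨by linarith [Real.pi_pos], by linarith [Real.pi_pos]⟩,
        Real.sin_pi_div_six]
      exact h4
    unfold hypAlpha
    linarith
  rw [Metric.tendsto_atTop']
  intro ε hε
  have h6 := (hlim.eventually_const_lt (hlt ε hε)).and (eventually_ge_atTop 1)
  obtain ⟨N, hN⟩ := eventually_atTop.1 h6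
  refine ⟨N, fun k hk => ?_⟩
  obtain ⟨h7, h8⟩ := hN k (le_of_lt hk)
  have hp := (hr k h8).1
  rw [Real.dist_eq, sub_zero, abs_of_pos hp]
  by_contra hge
  push Not at hge
  have h9 : hypAlpha (r k) ≤ hypAlpha ε := by
    unfold hypAlpha
    have hcc : Real.cosh ε ≤ Real.cosh (r k) := by
      rw [Real.cosh_le_cosh, abs_of_pos hε, abs_of_pos hp]
      exact hge
    have : 1 / (2 * Real.cosh (r k)) ≤ 1 / (2 * Real.cosh ε) :=
      one_div_le_one_div_of_le (by linarith [Real.cosh_pos ε]) (by linarith)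
    linarith [Real.monotone_arcsin this]
  linarith
end

section
/- Let χ < 0 and n ≥ 0 be integers with 6χ + 3n ≤ 3, and for each integer k ≥ 1 let r_k be the unique positive real with (6 − (6χ+3n)/k)·α(r_k) + (2n/k)·β(r_k) = 2π. Then the sequence (α(r_k)) is strictly increasing and converges to π/3, and the sequence (β(r_k)) is strictly increasing and converges to π/2, as k → ∞. -/
open Real Filter

theorem stmt_9 (χ n : ℤ) (hχ : χ < 0) (hn : 0 ≤ n)
    (hcond : 6 * χ + 3 * n ≤ 3) (r : ℕ → ℝ)
    (hr : ∀ k : ℕ, 1 ≤ k → 0 < r k ∧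
      (6 - ((6 * χ + 3 * n : ℤ) : ℝ) / (k : ℝ)) * hypAlpha (r k)
        + (((2 * n : ℤ) : ℝ) / (k : ℝ)) * hypBeta (r k) = 2 * Real.pi) :
    StrictMonoOn (fun k : ℕ => hypAlpha (r k)) (Set.Ici 1) ∧
    Tendsto (fun k : ℕ => hypAlpha (r k)) atTop (nhds (Real.pi / 3)) ∧
    StrictMonoOn (fun k : ℕ => hypBeta (r k)) (Set.Ici 1) ∧
    Tendsto (fun k : ℕ => hypBeta (r k)) atTop (nhds (Real.pi / 2)) := by
  have hx0 : ∀ k, 0 < 1 / Real.cosh (r k) := fun k => by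
    have := Real.cosh_pos (r k)
    positivity
  have hx1 : ∀ k, 1 ≤ k → 1 / Real.cosh (r k) < 1 := fun k hk => by
    have h := Real.one_lt_cosh.2 (hr k hk).1.ne'
    rw [div_lt_one (by linarith)]
    exact h
  obtain ⟨x, hx⟩ : ∃ x : ℕ → ℝ, ∀ k, x k = 1 / Real.cosh (r k) := ⟨_, fun _ => rfl⟩
  have hA : ∀ k, hypAlpha (r k) = 2 * Real.arcsin (x k / 2) := fun k => by
    have := (Real.cosh_pos (r k)).ne'
    rw [hypAlpha, hx]
    congr 2
    field_simp
  have hB : ∀ k, hypBeta (r k) = Real.arcsin (x k) := fun k => by rw [hypBeta, hx]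
  simp only [← hx] at hx0 hx1
  have hm : ((6 * χ + 3 * n : ℤ) : ℝ) ≤ 3 := by exact_mod_cast hcond
  have hn' : (0:ℝ) ≤ ((2 * n : ℤ) : ℝ) := by
    have : 0 ≤ 2 * n := by omega
    exact_mod_cast this
  simp only [hA, hB] at hr ⊢
  generalize ((6 * χ + 3 * n : ℤ) : ℝ) = m at *
  generalize ((2 * n : ℤ) : ℝ) = p at *
  have h6 : Real.arcsin (1 / 2) = Real.pi / 6 := by
    rw [← Real.sin_pi_div_six, Real.arcsin_sin] <;> linarith [Real.pi_pos]
  have hlt : ∀ k, 1 ≤ k → Real.arcsin (x k / 2) < Real.pi / 6 := fun k hk => by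
    rw [← h6]
    apply Real.arcsin_lt_arcsin <;> linarith [hx0 k, hx1 k hk]
  have hxm : ∀ j k, 1 ≤ j → j < k → x j < x k := by
    intro j k hj hjk
    by_contra! hle
    have hk : 1 ≤ k := by omega
    have e1 := (hr j hj).2
    have e2 := (hr k hk).2
    have a1 := hlt j hj
    have ha : Real.arcsin (x k / 2) ≤ Real.arcsin (x j / 2) :=
      Real.monotone_arcsin (by linarith)
    have hb : Real.arcsin (x k) ≤ Real.arcsin (x j) := Real.monotone_arcsin hle
    have hj0 : (1:ℝ) ≤ j := by exact_mod_cast hj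
    have hk0 : (1:ℝ) ≤ k := by exact_mod_cast hk
    have hjk0 : (j:ℝ) < k := by exact_mod_cast hjk
    generalize Real.arcsin (x k / 2) = ak at *
    generalize Real.arcsin (x j / 2) = aj at *
    generalize Real.arcsin (x k) = bk at *
    generalize Real.arcsin (x j) = bj at *
    have f1 : (6 * j - m) * (2 * aj) + p * bj = 2 * Real.pi * j := by
      rw [← e1]; field_simp
    have f2 : (6 * k - m) * (2 * ak) + p * bk = 2 * Real.pi * k := by
      rw [← e2]; field_simp
    have g1 : (6 * k - m) * (2 * ak) ≤ (6 * k - m) * (2 * aj) :=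
      mul_le_mul_of_nonneg_left (by linarith) (by linarith)
    have g2 : p * bk ≤ p * bj := mul_le_mul_of_nonneg_left hb hn'
    have g3 : 0 < ((k:ℝ) - j) * (Real.pi / 6 - aj) := mul_pos (by linarith) (by linarith)
    nlinarith
  have hT : Tendsto (fun k : ℕ => 2 * Real.arcsin (x k / 2)) atTop (nhds (Real.pi / 3)) := by
    have hb : Tendsto (fun k : ℕ => ((|m| * Real.pi + p * Real.pi) / 6) / (k:ℝ)) atTop (nhds 0) :=
      tendsto_const_div_atTop_nhds_zero_nat _
    rw [tendsto_iff_dist_tendsto_zero]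
    refine squeeze_zero' (Eventually.of_forall fun _ => dist_nonneg) ?_ hb
    filter_upwards [eventually_ge_atTop 1] with k hk
    have hk0 : (1:ℝ) ≤ k := by exact_mod_cast hk
    have e2 := (hr k hk).2
    have e : 2 * Real.arcsin (x k / 2) - Real.pi / 3
        = ((m * (2 * Real.arcsin (x k / 2)) - p * Real.arcsin (x k)) / 6) / k := by
      field_simp at e2 ⊢
      linarith
    rw [Real.dist_eq, e, abs_div, abs_div, abs_of_pos (by linarith : (0:ℝ) < k),
      abs_of_pos (by norm_num : (0:ℝ) < 6)]
    have q0 : 0 ≤ Real.arcsin (x k / 2) := Real.arcsin_nonneg.2 (by linarith [hx0 k])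
    have q1 := hlt k hk
    have q2 : 0 ≤ Real.arcsin (x k) := Real.arcsin_nonneg.2 (by linarith [hx0 k])
    have q3 := Real.arcsin_le_pi_div_two (x k)
    have hpi := Real.pi_pos
    gcongr
    refine (abs_sub _ _).trans ?_
    rw [abs_mul m, abs_mul p, abs_of_nonneg hn', abs_of_nonneg q2,
      abs_of_nonneg (by linarith : 0 ≤ 2 * Real.arcsin (x k / 2))]
    gcongr <;> linarith
  refine ⟨?_, hT, ?_, ?_⟩
  · intro j hj k hk hjk
    have h := hxm j k hj hjk
    have := Real.arcsin_lt_arcsin (x := x j / 2) (y := x k / 2) (by linarith [hx0 j])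
      (by linarith) (by linarith [hx1 k hk])
    simp only
    linarith
  · intro j hj k hk hjk
    exact Real.arcsin_lt_arcsin (by linarith [hx0 j]) (hxm j k hj hjk) (hx1 k hk).le
  · have h1 : Tendsto (fun k : ℕ => Real.arcsin (2 * Real.sin (2 * Real.arcsin (x k / 2) / 2)))
        atTop (nhds (Real.arcsin (2 * Real.sin (Real.pi / 3 / 2)))) :=
      ((Real.continuous_arcsin.comp
        (continuous_const.mul (Real.continuous_sin.comp (continuous_id.div_const 2)))).tendsto
          (Real.pi / 3)).comp hT
    have h2 : Real.arcsin (2 * Real.sin (Real.pi / 3 / 2)) = Real.pi / 2 := by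
      rw [show Real.pi / 3 / 2 = Real.pi / 6 by ring, Real.sin_pi_div_six]
      norm_num
    rw [h2] at h1
    refine h1.congr' ?_
    filter_upwards [eventually_ge_atTop 1] with k hk
    rw [mul_div_cancel_left₀ _ (by norm_num : (2:ℝ) ≠ 0),
      Real.sin_arcsin (by linarith [hx0 k]) (by linarith [hx1 k hk])]
    congr 1
    ring
end

section
/- Let χ < 0 and n ≥ 1 be integers with 6χ + 3n ≤ 3, and for each integer k ≥ 1 let r_k be the unique positive real with (6 − (6χ+3n)/k)·α(r_k) + (2n/k)·β(r_k) = 2π. Then there exists K such that for all k ≥ K one has 2π/7 < α(r_k) < π/3; in particular, for all k ≥ K there is no positive integer i with i·α(r_k) = 2π. -/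
open Real

theorem stmt_11 (χ n : ℤ) (hχ : χ < 0) (hn : 1 ≤ n)
    (hcond : 6 * χ + 3 * n ≤ 3) (r : ℕ → ℝ)
    (hr : ∀ k : ℕ, 1 ≤ k → 0 < r k ∧
      (6 - ((6 * χ + 3 * n : ℤ) : ℝ) / (k : ℝ)) * hypAlpha (r k)
        + (((2 * n : ℤ) : ℝ) / (k : ℝ)) * hypBeta (r k) = 2 * Real.pi) :
    ∃ K : ℕ, ∀ k : ℕ, K ≤ k →
      (2 * Real.pi / 7 < hypAlpha (r k) ∧ hypAlpha (r k) < Real.pi / 3) ∧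
      ¬ ∃ i : ℕ, 0 < i ∧ (i : ℝ) * hypAlpha (r k) = 2 * Real.pi := by
  obtain ⟨M, hM⟩ : ∃ M : ℤ, M = |6 * χ + 3 * n| := ⟨_, rfl⟩
  have hM0 : 0 ≤ M := hM ▸ abs_nonneg _
  refine ⟨(4 * (M + n)).toNat + 1, fun k hk => ?_⟩
  have hk1 : 1 ≤ k := by omega
  obtain ⟨hpos, heq⟩ := hr k hk1
  have hkM : 4 * (M + n) + 1 ≤ (k : ℤ) := by omega
  have hkR : 4 * ((M : ℝ) + n) + 1 ≤ (k : ℝ) := by exact_mod_cast hkM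
  have hk0 : (0 : ℝ) < k := by exact_mod_cast hk1
  have hpi := Real.pi_pos
  have hc : 1 < Real.cosh (r k) := Real.one_lt_cosh.2 hpos.ne'
  have ha0 : 0 ≤ hypAlpha (r k) := by
    unfold hypAlpha
    have : 0 ≤ Real.arcsin (1 / (2 * Real.cosh (r k))) := Real.arcsin_nonneg.2 (by positivity)
    linarith
  have ha1 : hypAlpha (r k) < Real.pi / 3 := by
    unfold hypAlpha
    have : Real.arcsin (1 / (2 * Real.cosh (r k))) < Real.pi / 6 := by
      rw [Real.arcsin_lt_iff_lt_sin' ⟨by linarith, by linarith⟩, Real.sin_pi_div_six]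
      exact one_div_lt_one_div_of_lt (by norm_num) (by linarith)
    linarith
  have hb : hypBeta (r k) ≤ Real.pi / 2 := Real.arcsin_le_pi_div_two _
  generalize hypAlpha (r k) = a at *
  generalize hypBeta (r k) = b at *
  have hMm : -((6 * χ + 3 * n : ℤ) : ℝ) ≤ (M : ℝ) := by
    rw [hM]; exact_mod_cast neg_le_abs _
  have hM0' : (0 : ℝ) ≤ M := by exact_mod_cast hM0
  have hn' : (1 : ℝ) ≤ n := by exact_mod_cast hn
  generalize ((6 * χ + 3 * n : ℤ) : ℝ) = m at *
  have heq2 : (6 * k - m) * a + 2 * n * b = 2 * Real.pi * k := by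
    push_cast at heq
    field_simp at heq
    linarith
  have hlow : 2 * Real.pi / 7 < a := by
    by_contra hcon
    push Not at hcon
    have h1 : (k : ℝ) * a ≤ k * (2 * Real.pi / 7) := mul_le_mul_of_nonneg_left hcon hk0.le
    have h2 : -m * a ≤ M * a := mul_le_mul_of_nonneg_right hMm ha0
    have h3 : (M : ℝ) * a ≤ M * (Real.pi / 3) := mul_le_mul_of_nonneg_left ha1.le hM0'
    have h4 : (n : ℝ) * b ≤ n * (Real.pi / 2) := mul_le_mul_of_nonneg_left hb (by linarith)
    have h5 := mul_le_mul_of_nonneg_left hkR hpi.le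
    have h6 := mul_nonneg hpi.le hM0'
    have h7 : 0 ≤ Real.pi * (n : ℝ) := mul_nonneg hpi.le (by linarith)
    nlinarith
  refine ⟨⟨hlow, ha1⟩, ?_⟩
  rintro ⟨i, hi, hia⟩
  have hap : 0 < a := by linarith
  have h1 : i < 7 := by
    by_contra h
    have : (7 : ℝ) ≤ i := by exact_mod_cast not_lt.1 h
    nlinarith
  have h2 : 6 < i := by
    by_contra h
    have : (i : ℝ) ≤ 6 := by exact_mod_cast not_lt.1 h
    nlinarith
  omega
end

section
/- Let a, b ≥ 0, h > 0 and ε > 0 be reals with sinh h·sinh(ε/2) < 1. Set u = sinh h·sinh(ε/2), let ψ ∈ [0, π] satisfy cos ψ = 2u² − 1, and let y ≥ 0 satisfy cosh y = cosh(ε/2)/√(1 − u²). Then (1/2)·[(1 − cos ψ)·cosh(2y + a + b) − (1 + cos ψ)·cosh(a − b)] = cosh ε·cosh(a+b) + sinh ε·cosh h·sinh(a+b) + u²·(cosh(a+b) − cosh(a−b)). -/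
open Real

theorem stmt_14 (a b h ε u ψ y : ℝ) (ha : 0 ≤ a) (hb : 0 ≤ b) (hh : 0 < h)
    (hε : 0 < ε) (hu : u = Real.sinh h * Real.sinh (ε / 2))
    (hsmall : Real.sinh h * Real.sinh (ε / 2) < 1)
    (hψ0 : 0 ≤ ψ) (hψπ : ψ ≤ Real.pi) (hψ : Real.cos ψ = 2 * u ^ 2 - 1)
    (hy0 : 0 ≤ y)
    (hy : Real.cosh y = Real.cosh (ε / 2) / Real.sqrt (1 - u ^ 2)) :
    (1 / 2) * ((1 - Real.cos ψ) * Real.cosh (2 * y + a + b)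
        - (1 + Real.cos ψ) * Real.cosh (a - b)) =
      Real.cosh ε * Real.cosh (a + b)
        + Real.sinh ε * Real.cosh h * Real.sinh (a + b)
        + u ^ 2 * (Real.cosh (a + b) - Real.cosh (a - b)) := by
  have hS : 0 < Real.sinh (ε / 2) := Real.sinh_pos_iff.mpr (by linarith)
  have hH : 0 < Real.sinh h := Real.sinh_pos_iff.mpr hh
  have hu0 : 0 < u := by rw [hu]; positivity
  have hu1 : u < 1 := by rw [hu]; exact hsmall
  have hw : 0 < 1 - u ^ 2 := by nlinarith
  obtain ⟨w, hwdef⟩ : ∃ w, w = Real.sqrt (1 - u ^ 2) := ⟨_, rfl⟩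
  have hwpos : 0 < w := by rw [hwdef]; exact Real.sqrt_pos.mpr hw
  have hw2 : w ^ 2 = 1 - u ^ 2 := by rw [hwdef]; exact Real.sq_sqrt hw.le
  rw [← hwdef] at hy
  have h1 : w * Real.cosh y = Real.cosh (ε / 2) := by rw [hy]; field_simp
  have hC := Real.cosh_sq (ε / 2)
  have hCh := Real.cosh_sq h
  have hCy := Real.cosh_sq y
  have h2 : w * Real.sinh y = Real.sinh (ε / 2) * Real.cosh h := by
    have hy1 : 0 ≤ Real.sinh y := Real.sinh_nonneg_iff.mpr hy0
    have hc : 0 < Real.cosh h := Real.cosh_pos h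
    refine (sq_eq_sq₀ (by positivity) (by positivity)).mp ?_
    have h3 : w ^ 2 * Real.cosh y ^ 2 = Real.cosh (ε / 2) ^ 2 := by rw [← h1]; ring
    rw [mul_pow, mul_pow, hCh]
    rw [hCy, hC] at h3
    have h4 : u ^ 2 = Real.sinh h ^ 2 * Real.sinh (ε / 2) ^ 2 := by rw [hu]; ring
    linear_combination h3 - hw2 + h4
  have e1 : Real.cosh ε = Real.cosh (ε / 2) ^ 2 + Real.sinh (ε / 2) ^ 2 := by
    rw [← Real.cosh_two_mul]; congr 1; ring
  have e2 : Real.sinh ε = 2 * Real.sinh (ε / 2) * Real.cosh (ε / 2) := by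
    rw [← Real.sinh_two_mul]; congr 1; ring
  have k1 : (1 - u ^ 2) * Real.cosh (2 * y) = Real.cosh ε + u ^ 2 := by
    rw [Real.cosh_two_mul, e1, ← hw2]
    have h3 : w ^ 2 * Real.cosh y ^ 2 = Real.cosh (ε / 2) ^ 2 := by rw [← h1]; ring
    linear_combination 2 * h3 - w ^ 2 * hCy + hC - hw2
  have k2 : (1 - u ^ 2) * Real.sinh (2 * y) = Real.sinh ε * Real.cosh h := by
    rw [Real.sinh_two_mul, e2, ← hw2, ← h1]
    linear_combination 2 * w * Real.cosh y * h2
  have e3 : Real.cosh (2 * y + a + b) = Real.cosh (2 * y) * Real.cosh (a + b)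
      + Real.sinh (2 * y) * Real.sinh (a + b) := by
    rw [← Real.cosh_add]; congr 1; ring
  rw [hψ, e3]
  linear_combination Real.cosh (a + b) * k1 + Real.sinh (a + b) * k2
end

section
/- Let a, b ≥ 0, h > 0 and ε > 0 be reals with sinh h·sinh(ε/2) > 1. Set u = sinh h·sinh(ε/2), let d ≥ 0 satisfy cosh d = 2u² − 1, and let y ≥ 0 satisfy cosh y = cosh h·sinh(ε/2)/√(u² − 1). Then (1/2)·[cosh(2y + a + b)·(cosh d − 1) − cosh(a − b)·(cosh d + 1)] = cosh ε·cosh(a+b) + sinh ε·cosh h·sinh(a+b) + u²·(cosh(a+b) − cosh(a−b)). -/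
open Real

theorem stmt_15 (a b h ε u d y : ℝ) (ha : 0 ≤ a) (hb : 0 ≤ b) (hh : 0 < h)
    (hε : 0 < ε) (hu : u = Real.sinh h * Real.sinh (ε / 2))
    (hbig : 1 < Real.sinh h * Real.sinh (ε / 2))
    (hd0 : 0 ≤ d) (hd : Real.cosh d = 2 * u ^ 2 - 1)
    (hy0 : 0 ≤ y)
    (hy : Real.cosh y = Real.cosh h * Real.sinh (ε / 2) / Real.sqrt (u ^ 2 - 1)) :
    (1 / 2) * (Real.cosh (2 * y + a + b) * (Real.cosh d - 1)
        - Real.cosh (a - b) * (Real.cosh d + 1)) =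
      Real.cosh ε * Real.cosh (a + b)
        + Real.sinh ε * Real.cosh h * Real.sinh (a + b)
        + u ^ 2 * (Real.cosh (a + b) - Real.cosh (a - b)) := by
  have hu1 : 1 < u := hu ▸ hbig
  have hpos : 0 < u ^ 2 - 1 := by nlinarith
  have hr : 0 < Real.sqrt (u ^ 2 - 1) := Real.sqrt_pos.mpr hpos
  have hr2 : Real.sqrt (u ^ 2 - 1) ^ 2 = u ^ 2 - 1 := Real.sq_sqrt hpos.le
  set r := Real.sqrt (u ^ 2 - 1) with hrdef
  have hcy : r * Real.cosh y = Real.cosh h * Real.sinh (ε / 2) := by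
    rw [hy]; field_simp
  have h1 := Real.cosh_sq h
  have h2 := Real.cosh_sq (ε / 2)
  have h3 := Real.cosh_sq y
  have hsy : r * Real.sinh y = Real.cosh (ε / 2) := by
    have hn : 0 ≤ r * Real.sinh y := mul_nonneg hr.le (Real.sinh_nonneg_iff.mpr hy0)
    have hsq : (r * Real.sinh y) ^ 2 = Real.cosh (ε / 2) ^ 2 := by
      have e1 : (r * Real.sinh y) ^ 2 = (r * Real.cosh y) ^ 2 - r ^ 2 := by
        rw [mul_pow, mul_pow, h3]; ring
      rw [e1, hcy, hr2, hu, mul_pow, mul_pow, h1, h2]; ring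
    exact (pow_left_inj₀ hn (Real.cosh_pos _).le two_ne_zero).mp hsq
  have hε1 : Real.cosh ε = Real.cosh (ε / 2) ^ 2 + Real.sinh (ε / 2) ^ 2 := by
    rw [← Real.cosh_two_mul]; congr 1; ring
  have hε2 : Real.sinh ε = 2 * Real.sinh (ε / 2) * Real.cosh (ε / 2) := by
    rw [← Real.sinh_two_mul]; congr 1; ring
  have key : (u ^ 2 - 1) * Real.cosh (2 * y + a + b) =
      ((Real.cosh h * Real.sinh (ε / 2)) ^ 2 + Real.cosh (ε / 2) ^ 2) * Real.cosh (a + b)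
      + 2 * Real.cosh (ε / 2) * (Real.cosh h * Real.sinh (ε / 2)) * Real.sinh (a + b) := by
    rw [add_assoc, Real.cosh_add, Real.cosh_two_mul, Real.sinh_two_mul, ← hr2, ← hcy, ← hsy]
    ring
  have hu2 : u ^ 2 = (Real.cosh h * Real.sinh (ε / 2)) ^ 2 - Real.sinh (ε / 2) ^ 2 := by
    rw [hu, mul_pow, mul_pow, h1]; ring
  rw [hd, hε1, hε2]
  linear_combination key - Real.cosh (a + b) * hu2
end
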